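/- arXiv:2309.04121 — 3 statements merged into one kernel-verified Lean document; each statement's English description precedes it below -/
import Mathlib

section
/- Let β ∈ F_{q²} with β ≠ 0, and let a, b, c ∈ F_{q²} with a^q + b ≠ 0. Set A₀ = β^{-1}(b − a^q)² − 8c, A₁ = β^{-1}(b² − a^{2q}) − 4c and A₂ = β^{-1}(a^q + b)². Then the number of zeros of −β^q·x^{2q} + β·x² + a·x^q + b·x + c in F_{q²} equals: 1 + η(N(β))·η(Tr(A₁)² + Tr(A₀·(A₂^q − A₂))) if A₂ ∉ F_q; 1 if A₂ ∈ F_q and Tr(A₁) ≠ 0; 1 − η(N(β)) if A₂ ∈ F_q, Tr(A₁) = 0 and A₀ ∉ F_q; and 1 + η(N(β))·(q − 1) if A₂ ∈ F_q, Tr(A₁) = 0 and A₀ ∈ F_q. -/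
open Finset
open scoped Classical

/-- Counting the transformed solutions in the case `A₂` not fixed. -/
theorem aux_count {K : Type} [Field K] [Fintype K] (σ : K →+* K)
    (hσ : ∀ x, σ (σ x) = x) (h2 : (2 : K) ≠ 0) (T A C d D : K)
    (hD : D ≠ 0) (hDA : σ A = A + D) (hT : σ T = T) 
    (hd : d ^ 2 = T ^ 2 * A * (A + D) + D * C) :
    (d = 0 → (Finset.univ.filter (fun s : K => s + σ s = T ∧
      s ^ 2 * σ A - (σ s) ^ 2 * A = C)).card = 1) ∧
    (d ≠ 0 → σ d = d → (Finset.univ.filter (fun s : K => s + σ s = T ∧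
      s ^ 2 * σ A - (σ s) ^ 2 * A = C)).card = 2) ∧
    (d ≠ 0 → σ d = -d → (Finset.univ.filter (fun s : K => s + σ s = T ∧
      s ^ 2 * σ A - (σ s) ^ 2 * A = C)).card = 0) := by
  have hσD : σ D = -D := by
    have := congrArg σ hDA
    rw [map_add, hσ] at this
    linear_combination -this - hDA
  have key : ∀ s : K, (s + σ s = T ∧ s ^ 2 * σ A - (σ s) ^ 2 * A = C) ↔
      (s + σ s = T ∧ (D * s + T * A - d) * (D * s + T * A + d) = 0) := by
    intro s
    refine and_congr_right fun h => ?_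
    have hs : σ s = T - s := by linear_combination h
    rw [hs, hDA]
    constructor
    · intro h1
      linear_combination D * h1 - hd
    · intro h1
      apply mul_left_cancel₀ hD
      linear_combination h1 + hd
  have root : ∀ s e : K, D * s + T * A = e → (s + σ s = T ↔ σ e = e) := by
    intro s e h
    have h1 : -D * σ s + T * (A + D) = σ e := by
      rw [← h, map_add, map_mul, map_mul, hσD, hT, hDA]
    constructor
    · intro h3
      linear_combination -h1 + h - D * h3
    · intro h3
      apply mul_left_cancel₀ hD
      linear_combination h - h1 - h3
  simp only [key]
  refine ⟨fun h => ?_, fun h0 h => ?_, fun h0 h => ?_⟩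
  · rw [Finset.card_eq_one]
    refine ⟨-(T * A) / D, ?_⟩
    ext s
    simp only [Finset.mem_filter, Finset.mem_univ, true_and, Finset.mem_singleton]
    rw [eq_div_iff hD]
    constructor
    · rintro ⟨-, h3⟩
      rw [h] at h3
      have : D * s + T * A = 0 := by
        rcases mul_eq_zero.1 h3 with h | h <;> linear_combination h
      linear_combination this
    · intro h3
      have h4 : D * s + T * A = 0 := by linear_combination h3
      exact ⟨(root s 0 h4).2 (map_zero σ), by rw [h4, h]; ring⟩
  · rw [Finset.card_eq_two]
    refine ⟨(d - T * A) / D, (-d - T * A) / D, ?_, ?_⟩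
    · intro h3
      rw [div_left_inj' hD] at h3
      have : 2 * d = 0 := by linear_combination h3
      exact (mul_ne_zero h2 h0) this
    ext s
    simp only [Finset.mem_filter, Finset.mem_univ, true_and, Finset.mem_singleton,
      Finset.mem_insert]
    rw [eq_div_iff hD, eq_div_iff hD]
    constructor
    · rintro ⟨-, h3⟩
      rcases mul_eq_zero.1 h3 with h | h
      · left; linear_combination h
      · right; linear_combination h
    · rintro (h3 | h3)
      · have h4 : D * s + T * A = d := by linear_combination h3
        exact ⟨(root s d h4).2 h, by rw [h4]; ring⟩
      · have h4 : D * s + T * A = -d := by linear_combination h3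
        exact ⟨(root s (-d) h4).2 (by rw [map_neg, h]), by rw [h4]; ring⟩
  · rw [Finset.card_eq_zero, Finset.filter_eq_empty_iff]
    rintro s - ⟨h1, h3⟩
    rcases mul_eq_zero.1 h3 with h4 | h4
    · have := (root s d (by linear_combination h4)).1 h1
      exact (mul_ne_zero h2 h0) (by linear_combination h - this)
    · have := (root s (-d) (by linear_combination h4)).1 h1
      rw [map_neg] at this
      exact (mul_ne_zero h2 h0) (by linear_combination this + h)

/-- The number of elements of trace zero. -/
theorem aux_ker {K : Type} [Field K] [Fintype K] (q : ℕ) (hq : 1 < q)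
    (hK : Fintype.card K = q ^ 2) (σ : K →+* K) (hσq : ∀ x, σ x = x ^ q)
    (hσ : ∀ x, σ (σ x) = x) :
    (Finset.univ.filter (fun s : K => s + σ s = 0)).card = q := by
  have bound : ∀ ε : K, (Finset.univ.filter (fun s : K => σ s + ε * s = 0)).card ≤ q := by
    intro ε
    have hdeg : (Polynomial.C ε * Polynomial.X : Polynomial K).degree < ((q : ℕ) : WithBot ℕ) :=
      lt_of_le_of_lt (Polynomial.degree_C_mul_X_le ε) (by exact_mod_cast hq)
    have hm := Polynomial.monic_X_pow_add hdeg
    have hnd : (Polynomial.X ^ q + Polynomial.C ε * Polynomial.X : Polynomial K).natDegree = q := by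
      rw [Polynomial.natDegree_eq_of_degree_eq_some]
      rw [Polynomial.degree_add_eq_left_of_degree_lt]
      · simp
      · simpa using hdeg
    have := Polynomial.card_le_degree_of_subset_roots (p := (Polynomial.X ^ q + Polynomial.C ε * Polynomial.X : Polynomial K))
      (Z := Finset.univ.filter (fun s : K => σ s + ε * s = 0)) (by
        intro s hs
        have hs' : σ s + ε * s = 0 := by simpa using hs
        rw [Polynomial.mem_roots hm.ne_zero]
        simpa [hσq] using hs')
    rwa [hnd] at this
  let f : K →+ K := AddMonoidHom.id K + (σ : K →+ K)
  have hf : ∀ x, f x = x + σ x := fun x => rfl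
  have h1 : Nat.card f.ker * Nat.card f.range = q ^ 2 := by
    rw [← hK, ← Nat.card_eq_fintype_card, ← AddSubgroup.index_ker f, AddSubgroup.card_mul_index]
  have h2 : Nat.card f.ker = (Finset.univ.filter (fun s : K => s + σ s = 0)).card := by
    rw [← Fintype.card_subtype, ← Nat.card_eq_fintype_card]
    rfl
  have h3 : Nat.card f.range ≤ q := by
    refine le_trans ?_ (bound (-1))
    rw [← Fintype.card_subtype, ← Nat.card_eq_fintype_card]
    refine Nat.card_le_card_of_injective (fun x => ⟨x.1, ?_⟩) ?_
    · obtain ⟨y, hy⟩ := x.2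
      rw [← hy, hf, map_add, hσ]; ring
    · intro x y h
      have h' : x.1 = y.1 := congrArg (fun z => z.1) h
      exact Subtype.ext h'
  have h4 : (Finset.univ.filter (fun s : K => s + σ s = 0)).card ≤ q := by
    have := bound 1
    simpa [add_comm] using this
  rw [h2] at h1
  nlinarith

/-- The change of variables `s = 4ux + uv/β`. -/
theorem aux_bij {K : Type} [Field K] [Fintype K] (σ : K →+* K)
    (hσ : ∀ x, σ (σ x) = x) (h2 : (2 : K) ≠ 0)
    (β a b c : K) (hβ : β ≠ 0) (hab : σ a + b ≠ 0)
    (A₀ A₁ A₂ : K)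
    (hA₀ : A₀ = β⁻¹ * (b - σ a) ^ 2 - 8 * c)
    (hA₁ : A₁ = β⁻¹ * (b ^ 2 - (σ a) ^ 2) - 4 * c)
    (hA₂ : A₂ = β⁻¹ * (σ a + b) ^ 2) :
    (Finset.univ.filter (fun x : K =>
      -σ β * (σ x) ^ 2 + β * x ^ 2 + a * σ x + b * x + c = 0)).card =
    (Finset.univ.filter (fun s : K => s + σ s = σ A₁ + A₁ ∧
      s ^ 2 * σ A₂ - (σ s) ^ 2 * A₂ = (A₀ - σ A₀) * (A₂ * σ A₂))).card := by
  have h4 : (4 : K) ≠ 0 := by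
    have : (4 : K) = 2 * 2 := by norm_num
    rw [this]; exact mul_ne_zero h2 h2
  have h8 : (8 : K) ≠ 0 := by
    have : (8 : K) = 2 * 4 := by norm_num
    rw [this]; exact mul_ne_zero h2 h4
  have hβ' : σ β ≠ 0 := by simpa using hβ
  have hab' : a + σ b ≠ 0 := by
    have : σ (σ a + b) ≠ 0 := (map_ne_zero σ).2 hab
    rwa [map_add, hσ] at this
  have hA20 : A₂ ≠ 0 := by
    rw [hA₂]; exact mul_ne_zero (inv_ne_zero hβ) (pow_ne_zero _ hab)
  have hA20' : σ A₂ ≠ 0 := by simpa using hA20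
  refine Finset.card_equiv ((Equiv.mulLeft₀ (4 * (σ a + b)) (mul_ne_zero h4 hab)).trans
    (Equiv.addRight ((σ a + b) * (b - σ a) * β⁻¹))) ?_
  intro x
  simp only [Finset.mem_filter, Finset.mem_univ, true_and, Equiv.trans_apply,
    Equiv.mulLeft₀_apply, Equiv.coe_addRight]
  set P := -σ β * (σ x) ^ 2 + β * x ^ 2 + a * σ x + b * x + c with hP
  have hσ4 : σ 4 = 4 := map_ofNat σ 4
  have hσ8 : σ 8 = 8 := map_ofNat σ 8
  have hP' : σ P = -β * x ^ 2 + σ β * (σ x) ^ 2 + σ a * x + σ b * σ x + σ c := by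
    rw [hP]; simp only [map_add, map_mul, map_neg, map_pow, hσ]
  set s := 4 * (σ a + b) * x + (σ a + b) * (b - σ a) * β⁻¹ with hs
  have hs' : σ s = 4 * (a + σ b) * σ x + (a + σ b) * (σ b - a) * (σ β)⁻¹ := by
    rw [hs]; simp only [map_add, map_sub, map_mul, map_inv₀, hσ, hσ4]
  have e1 : s + σ s - (σ A₁ + A₁) = 4 * (P + σ P) := by
    rw [hs', hP', hs, hP, hA₁]
    simp only [map_sub, map_mul, map_inv₀, map_pow, hσ, hσ4]
    ring
  have e2 : s ^ 2 * σ A₂ - (σ s) ^ 2 * A₂ - (A₀ - σ A₀) * (A₂ * σ A₂)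
      = 8 * (A₂ * σ A₂) * (P - σ P) := by
    rw [hs', hP', hs, hP, hA₀, hA₂]
    simp only [map_sub, map_add, map_mul, map_inv₀, map_pow, hσ, hσ8]
    field_simp
    ring
  constructor
  · intro h
    rw [h, map_zero] at e1 e2
    exact ⟨by linear_combination e1, by linear_combination e2⟩
  · rintro ⟨k1, k2⟩
    have f1 : P + σ P = 0 := by
      apply mul_left_cancel₀ h4
      linear_combination k1 - e1
    have f2 : P - σ P = 0 := by
      apply mul_left_cancel₀ (mul_ne_zero h8 (mul_ne_zero hA20 hA20'))
      linear_combination k2 - e2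
    apply mul_left_cancel₀ h2
    linear_combination f1 + f2

/-- Let `β ∈ F_{q²}` with `β ≠ 0`, and `a, b, c ∈ F_{q²}` with `a^q + b ≠ 0`.
Set `A₀ = β⁻¹(b − a^q)² − 8c`, `A₁ = β⁻¹(b² − a^{2q}) − 4c` and `A₂ = β⁻¹(a^q + b)²`.
Then the number of zeros of `−β^q·x^{2q} + β·x² + a·x^q + b·x + c` in `F_{q²}` equals:
`1 + η(N(β))·η(Tr(A₁)² + Tr(A₀·(A₂^q − A₂)))` if `A₂ ∉ F_q`; `1` if `A₂ ∈ F_q` and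
`Tr(A₁) ≠ 0`; `1 − η(N(β))` if `A₂ ∈ F_q`, `Tr(A₁) = 0` and `A₀ ∉ F_q`; and
`1 + η(N(β))·(q − 1)` if `A₂ ∈ F_q`, `Tr(A₁) = 0` and `A₀ ∈ F_q`.
Here `q` is a power of an odd prime, `K` plays the role of `F_{q²}`,
`F_q = {x : K | x^q = x}`, `Tr(x) = x^q + x`, `N(x) = x^{q+1}` and `η` is the quadratic
character of `F_q` (values in `ℤ`, `η(0) = 0`). -/
theorem stmt6 (p n q : ℕ) (hp : p.Prime) (hp2 : p ≠ 2) (hn : 0 < n)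
    (hq : q = p ^ n)
    (K : Type) [Field K] [Fintype K] (hK : Fintype.card K = q ^ 2)
    (η : K → ℤ) (hη0 : η 0 = 0)
    (hη1 : ∀ x : K, x ≠ 0 → (∃ y : K, y ^ q = y ∧ y ^ 2 = x) → η x = 1)
    (hη2 : ∀ x : K, x ≠ 0 → ¬ (∃ y : K, y ^ q = y ∧ y ^ 2 = x) → η x = -1)
    (β a b c : K) (hβ : β ≠ 0) (hab : a ^ q + b ≠ 0)
    (A₀ A₁ A₂ : K)
    (hA₀ : A₀ = β⁻¹ * (b - a ^ q) ^ 2 - 8 * c)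
    (hA₁ : A₁ = β⁻¹ * (b ^ 2 - a ^ (2 * q)) - 4 * c)
    (hA₂ : A₂ = β⁻¹ * (a ^ q + b) ^ 2)
    (Z : ℤ)
    (hZ : Z = ((Finset.univ.filter (fun x : K =>
      -β ^ q * x ^ (2 * q) + β * x ^ 2 + a * x ^ q + b * x + c = 0)).card : ℤ)) :
    (A₂ ^ q ≠ A₂ →
      Z = 1 + η (β ^ (q + 1)) *
        η ((A₁ ^ q + A₁) ^ 2 + ((A₀ * (A₂ ^ q - A₂)) ^ q + A₀ * (A₂ ^ q - A₂)))) ∧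
    (A₂ ^ q = A₂ → A₁ ^ q + A₁ ≠ 0 → Z = 1) ∧
    (A₂ ^ q = A₂ → A₁ ^ q + A₁ = 0 → A₀ ^ q ≠ A₀ → Z = 1 - η (β ^ (q + 1))) ∧
    (A₂ ^ q = A₂ → A₁ ^ q + A₁ = 0 → A₀ ^ q = A₀ →
      Z = 1 + η (β ^ (q + 1)) * ((q : ℤ) - 1)) := by
  have hp' : Fact p.Prime := ⟨hp⟩
  have hchar : CharP K p := by
    refine charP_of_card_eq_prime_pow (f := n * 2) (R := K) ?_
    rw [hK, hq, pow_mul]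
  have h2 : (2 : K) ≠ 0 := by
    apply Ring.two_ne_zero
    rw [ringChar.eq K p]; exact hp2
  have hq1 : 1 < q := by rw [hq]; exact Nat.one_lt_pow hn.ne' hp.one_lt
  have hqodd : Odd q := by rw [hq]; exact (hp.odd_of_ne_two hp2).pow
  obtain ⟨σ, hσq⟩ : ∃ σ : K →+* K, ∀ x, σ x = x ^ q :=
    ⟨iterateFrobenius K p n, fun x => by rw [iterateFrobenius_def, hq]⟩
  have hσ : ∀ x, σ (σ x) = x := by
    intro x
    rw [hσq, hσq, ← pow_mul, ← pow_two, ← hK, FiniteField.pow_card]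
  have hσq' : ∀ x, σ x = x ^ q := hσq
  have e2q : ∀ x : K, x ^ (2 * q) = (σ x) ^ 2 := fun x => by rw [hσq, ← pow_mul, mul_comm]
  have eq1 : β ^ (q + 1) = σ β * β := by rw [hσq, pow_succ]
  simp only [e2q, eq1, ← hσq] at hη1 hη2 hab hA₀ hA₁ hA₂ hZ ⊢
  have hβ' : σ β ≠ 0 := by simpa using hβ
  have hab' : σ (σ a + b) ≠ 0 := (map_ne_zero σ).2 hab
  have hA20 : A₂ ≠ 0 := by
    rw [hA₂]; exact mul_ne_zero (inv_ne_zero hβ) (pow_ne_zero _ hab)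
  have hA20' : σ A₂ ≠ 0 := by simpa using hA20
  rw [aux_bij σ hσ h2 β a b c hβ hab A₀ A₁ A₂ hA₀ hA₁ hA₂] at hZ
  have hsq : ∀ x : K, σ x = x → ∃ w, w ^ 2 = x ∧ (σ w = w ∨ σ w = -w) := by
    intro x hx
    by_cases hx0 : x = 0
    · exact ⟨0, by simp [hx0]⟩
    have : IsSquare x := by
      rw [FiniteField.isSquare_iff (by rw [ringChar.eq K p]; exact hp2) hx0, hK]
      obtain ⟨k, hk⟩ := hqodd
      have h1 : x ^ (2 * k) = 1 := by
        apply mul_right_cancel₀ hx0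
        rw [← pow_succ, ← hk, one_mul, ← hσq, hx]
      have h3 : q ^ 2 / 2 = (2 * k) * (k + 1) := by
        rw [hk, show (2 * k + 1) ^ 2 = 1 + 2 * ((2 * k) * (k + 1)) by ring]
        omega
      rw [h3, pow_mul, h1, one_pow]
    obtain ⟨w, hw⟩ := this
    refine ⟨w, by rw [hw]; ring, ?_⟩
    apply sq_eq_sq_iff_eq_or_eq_neg.1
    rw [← map_pow, pow_two, ← hw, hx]
  have hηp : ∀ w : K, w ≠ 0 → σ w = w → η (w ^ 2) = 1 := fun w h0 h =>
    hη1 _ (pow_ne_zero 2 h0) ⟨w, h, rfl⟩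
  have hηm : ∀ w : K, w ≠ 0 → σ w = -w → η (w ^ 2) = -1 := by
    intro w h0 h
    apply hη2 _ (pow_ne_zero 2 h0)
    rintro ⟨y, hy1, hy2⟩
    apply mul_ne_zero h2 h0
    rcases sq_eq_sq_iff_eq_or_eq_neg.1 hy2 with rfl | rfl
    · linear_combination h - hy1
    · rw [map_neg] at hy1
      linear_combination h + hy1
  obtain ⟨m, hm, hmσ⟩ := hsq (σ β * β) (by rw [map_mul, hσ, mul_comm])
  have hm0 : m ≠ 0 := by
    rintro rfl
    exact mul_ne_zero hβ' hβ (by rw [← hm]; ring)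
  rw [← hm]
  set u := σ a + b with hu
  have hAA : A₂ * σ A₂ * m ^ 2 = (u * σ u) ^ 2 := by
    rw [hm, hA₂, map_mul, map_inv₀, map_pow]
    field_simp
  have hT : σ (σ A₁ + A₁) = σ A₁ + A₁ := by rw [map_add, hσ, add_comm]
  have hN : σ (u * σ u) = u * σ u := by rw [map_mul, hσ, mul_comm]
  have hN0 : u * σ u ≠ 0 := mul_ne_zero hab hab'
  have hfix : σ A₂ = A₂ → η (m ^ 2) = 1 := by
    intro h
    apply hηp m hm0
    have h1 : (A₂ * m) ^ 2 = (u * σ u) ^ 2 := by rw [← hAA, h]; ring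
    apply mul_left_cancel₀ hA20
    nth_rewrite 1 [← h]
    rw [← map_mul]
    rcases sq_eq_sq_iff_eq_or_eq_neg.1 h1 with h3 | h3
    · rw [h3, hN]
    · rw [h3, map_neg, hN]
  set T := σ A₁ + A₁ with hTdef
  refine ⟨fun hne => ?_, fun h hT0 => ?_, fun h hT0 h0 => ?_, fun h hT0 h0 => ?_⟩
  · have hE : σ (σ A₂ - A₂) = -(σ A₂ - A₂) := by rw [map_sub, hσ]; ring
    have hΔ : T ^ 2 + (σ (A₀ * (σ A₂ - A₂)) + A₀ * (σ A₂ - A₂))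
        = T ^ 2 + (A₀ - σ A₀) * (σ A₂ - A₂) := by
      rw [map_mul, hE]; ring
    rw [hΔ]
    obtain ⟨e, he, heσ⟩ := hsq (T ^ 2 + (A₀ - σ A₀) * (σ A₂ - A₂)) (by
      rw [map_add, map_pow, map_mul, hE, hT, map_sub, hσ]; ring)
    rw [← he]
    obtain ⟨c0, c1, c2⟩ := aux_count σ hσ h2 T A₂ ((A₀ - σ A₀) * (A₂ * σ A₂))
      (u * σ u * e / m) (σ A₂ - A₂) (sub_ne_zero.2 hne) (by ring) hT (by
        rw [div_pow, mul_pow, ← hAA, he]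
        field_simp
        ring)
    by_cases he0 : e = 0
    · rw [hZ, c0 (by simp [he0]), he0]
      simp [hη0]
    have hd0 : u * σ u * e / m ≠ 0 := div_ne_zero (mul_ne_zero hN0 he0) hm0
    have hdσ : σ (u * σ u * e / m) = u * σ u * σ e / σ m := by
      rw [map_div₀, map_mul, hN]
    rw [hdσ] at c1 c2
    rw [hZ]
    rcases hmσ with h3 | h3 <;> rcases heσ with h5 | h5
    · rw [c1 hd0 (by rw [h3, h5]), hηp m hm0 h3, hηp e he0 h5]; norm_num
    · rw [c2 hd0 (by rw [h3, h5]; ring), hηp m hm0 h3, hηm e he0 h5]; norm_num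
    · rw [c2 hd0 (by rw [h3, h5, div_neg]), hηm m hm0 h3, hηp e he0 h5]; norm_num
    · rw [c1 hd0 (by rw [h3, h5, div_neg]; ring), hηm m hm0 h3, hηm e he0 h5]; norm_num
  · rw [hZ]
    norm_cast
    rw [Finset.card_eq_one]
    refine ⟨(T ^ 2 + (A₀ - σ A₀) * A₂) / (2 * T), ?_⟩
    have h2T : 2 * T ≠ 0 := mul_ne_zero h2 hT0
    ext s
    simp only [Finset.mem_filter, Finset.mem_univ, true_and, Finset.mem_singleton, h]
    constructor
    · rintro ⟨k1, k2⟩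
      rw [eq_div_iff h2T]
      have k3 : σ s = T - s := by linear_combination k1
      rw [k3] at k2
      apply mul_left_cancel₀ hA20
      linear_combination k2
    · rintro rfl
      have k3 : σ ((T ^ 2 + (A₀ - σ A₀) * A₂) / (2 * T))
          = (T ^ 2 + (σ A₀ - A₀) * A₂) / (2 * T) := by
        simp only [map_div₀, map_add, map_mul, map_sub, map_pow, hσ, hT, h, map_ofNat]
      rw [k3]
      constructor
      · field_simp
        ring
      · field_simp
        ring
  · rw [hZ, hfix h]
    norm_num
    intro s k1 k2
    apply h0
    have k3 : σ s = - s := by linear_combination k1 + hT0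
    rw [h, k3] at k2
    have : (A₀ - σ A₀) * (A₂ * A₂) = 0 := by linear_combination -k2
    have := (mul_eq_zero.1 this).resolve_right (mul_ne_zero hA20 hA20)
    linear_combination -this
  · rw [hZ, hfix h]
    have : (Finset.univ.filter (fun s : K => s + σ s = T ∧
      s ^ 2 * σ A₂ - (σ s) ^ 2 * A₂ = (A₀ - σ A₀) * (A₂ * σ A₂)))
      = Finset.univ.filter (fun s : K => s + σ s = 0) := by
      ext s
      simp only [Finset.mem_filter, Finset.mem_univ, true_and, hT0]
      constructor
      · exact fun k => k.1
      · intro k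
        refine ⟨k, ?_⟩
        have k3 : σ s = - s := by linear_combination k
        rw [k3, h, h0]; ring
    rw [this, aux_ker q hq1 hK σ hσq' hσ]
    ring
end

section
/- Let q be a power of an odd prime, let a, b, c ∈ F_{q²} and d ∈ F_{q²} \ F_q, and set γ = a² − ab + c, δ = a − b + d and ε = a^q − a − b^q + b. Then the rational function (x^{q+1} + x² + a·x^q + b·x + c)/(x^q + x + d) is a permutation rational function of F_{q²} if and only if γ ∈ {0, −ε²}, δ = 0 and ε ≠ 0. -/
open Finset

/-- Nonzero `δ` is impossible: fibres of the trace are mapped to lines that must be parallel. -/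
lemma delta_zero {K : Type} [Field K] (σ : K →+* K) (hσ : ∀ x, σ (σ x) = x)
    (h2 : (2 : K) ≠ 0) (γ δ e : K) (he : σ e ≠ e)
    (hinj : Function.Injective (fun y : K => (y * (y + σ y + e - δ) + γ) / (y + σ y + e))) :
    δ = 0 := by
  have hne : ∀ T : K, σ T = T → T + e ≠ 0 := by
    intro T hT h
    apply he
    have : e = -T := by linear_combination h
    rw [this, map_neg, hT]
  have hne' : ∀ T : K, σ T = T → T + σ e ≠ 0 := by
    intro T hT h
    have := congrArg σ h
    rw [map_add, hσ, hT, map_zero] at this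
    exact hne T hT this
  have key : ∀ T1 T2 : K, σ T1 = T1 → σ T2 = T2 → T1 ≠ T2 →
      (T1 + e - δ) * (T1 + σ e) * ((T2 + σ e - σ δ) * (T2 + e)) =
      (T1 + σ e - σ δ) * (T1 + e) * ((T2 + e - δ) * (T2 + σ e)) := by
    intro T1 T2 hT1 hT2 h12
    by_contra hcon
    have n1 := hne T1 hT1
    have n2 := hne T2 hT2
    have n1' := hne' T1 hT1
    have n2' := hne' T2 hT2
    obtain ⟨m1, hm1⟩ : ∃ m, m = (T1 + e - δ) / (T1 + e) := ⟨_, rfl⟩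
    obtain ⟨m2, hm2⟩ : ∃ m, m = (T2 + e - δ) / (T2 + e) := ⟨_, rfl⟩
    have hs1 : σ m1 = (T1 + σ e - σ δ) / (T1 + σ e) := by rw [hm1]; simp [hT1]
    have hs2 : σ m2 = (T2 + σ e - σ δ) / (T2 + σ e) := by rw [hm2]; simp [hT2]
    have hΔ : m1 * σ m2 - σ m1 * m2 ≠ 0 := by
      intro h
      apply hcon
      rw [hs1, hs2, hm1, hm2] at h
      field_simp at h
      linear_combination h
    obtain ⟨r, hr⟩ : ∃ r, r = (m2 * (T2 / 2) + γ / (T2 + e)) - (m1 * (T1 / 2) + γ / (T1 + e)) :=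
      ⟨_, rfl⟩
    obtain ⟨k1, hk1⟩ : ∃ k, k = (r * σ m2 + σ r * m2) / (m1 * σ m2 - σ m1 * m2) := ⟨_, rfl⟩
    obtain ⟨k2, hk2⟩ : ∃ k, k = (r * σ m1 + σ r * m1) / (m1 * σ m2 - σ m1 * m2) := ⟨_, rfl⟩
    have hΔ' : σ m1 * m2 - m1 * σ m2 ≠ 0 := by
      intro h; apply hΔ; linear_combination -h
    have c1 : σ k1 = -k1 := by
      rw [hk1]; simp only [map_div₀, map_add, map_sub, map_mul, hσ]
      rw [show σ m1 * m2 - m1 * σ m2 = -(m1 * σ m2 - σ m1 * m2) by ring, div_neg]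
      congr 2
      ring
    have c2 : σ k2 = -k2 := by
      rw [hk2]; simp only [map_div₀, map_add, map_sub, map_mul, hσ]
      rw [show σ m1 * m2 - m1 * σ m2 = -(m1 * σ m2 - σ m1 * m2) by ring, div_neg]
      congr 2
      ring
    have hmk : m1 * k1 - m2 * k2 = r := by
      rw [hk1, hk2, ← mul_div_assoc, ← mul_div_assoc, ← sub_div, div_eq_iff hΔ]; ring
    have t1 : (T1 / 2 + k1) + σ (T1 / 2 + k1) = T1 := by
      simp only [map_div₀, map_add, hT1, c1, map_ofNat]; field_simp; ring
    have t2 : (T2 / 2 + k2) + σ (T2 / 2 + k2) = T2 := by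
      simp only [map_div₀, map_add, hT2, c2, map_ofNat]; field_simp; ring
    have heq : T1 / 2 + k1 = T2 / 2 + k2 := by
      apply hinj
      simp only [t1, t2]
      have e1 : ((T1 / 2 + k1) * (T1 + e - δ) + γ) / (T1 + e)
          = m1 * (T1 / 2 + k1) + γ / (T1 + e) := by rw [hm1]; ring
      have e2 : ((T2 / 2 + k2) * (T2 + e - δ) + γ) / (T2 + e)
          = m2 * (T2 / 2 + k2) + γ / (T2 + e) := by rw [hm2]; ring
      rw [e1, e2]
      linear_combination hmk + hr
    apply h12
    rw [← t1, ← t2, heq]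
  have h11 : (1 : K) ≠ -1 := by
    intro h; apply h2; linear_combination h
  have k1 := key 0 1 (map_zero _) (map_one _) (by simp)
  have k2 := key 0 (-1) (map_zero _) (by simp) (by simp)
  have k3 := key 1 (-1) (map_one _) (by simp) h11
  have hb0 : (e - δ) * σ e = (σ e - σ δ) * e := by
    apply mul_left_cancel₀ h2
    linear_combination k1 + k2
  have hab : (e - δ) * σ e * (σ δ - δ) = 0 := by
    linear_combination (-1) * k1 + (1 + (e - δ) + σ e) * hb0
  have hb1 : σ δ - δ = 0 := by
    apply mul_left_cancel₀ h2
    linear_combination k3 + 2 * (e - δ + σ e) * hb0 - 2 * hab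
  have h3 : δ * (e - σ e) = 0 := by linear_combination hb0 - e * hb1
  rcases mul_eq_zero.1 h3 with h | h
  · exact h
  · exact absurd (by linear_combination -h) he

lemma inj_of {K : Type} [Field K] (σ : K →+* K) (hσ : ∀ x, σ (σ x) = x)
    (h2 : (2 : K) ≠ 0) (γ e : K) (he : σ e ≠ e) (hγ : γ = 0 ∨ γ = -(e - σ e) ^ 2) :
    Function.Injective (fun y : K => y + γ / (y + σ y + e)) := by
  rcases hγ with hγ | hγ
  · intro x y h; simpa [hγ] using h
  have hne : ∀ T : K, σ T = T → T + e ≠ 0 := by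
    intro T hT h
    apply he
    have : e = -T := by linear_combination h
    rw [this, map_neg, hT]
  have hne' : ∀ T : K, σ T = T → T + σ e ≠ 0 := by
    intro T hT h
    have := congrArg σ h
    rw [map_add, hσ, hT, map_zero] at this
    exact hne T hT this
  have hsγ : σ γ = γ := by rw [hγ]; simp [hσ]; ring
  intro y1 y2 h
  simp only at h
  obtain ⟨T1, hT1⟩ : ∃ T, T = y1 + σ y1 := ⟨_, rfl⟩
  obtain ⟨T2, hT2⟩ : ∃ T, T = y2 + σ y2 := ⟨_, rfl⟩
  rw [← hT1, ← hT2] at h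
  have f1 : σ T1 = T1 := by rw [hT1]; simp [hσ]; ring
  have f2 : σ T2 = T2 := by rw [hT2]; simp [hσ]; ring
  have h' := congrArg σ h
  simp only [map_add, map_div₀, hsγ, f1, f2] at h'
  have hh : T1 + γ / (T1 + e) + γ / (T1 + σ e) = T2 + γ / (T2 + e) + γ / (T2 + σ e) := by
    linear_combination h + h' + hT1 - hT2
  have n1 := hne T1 f1
  have n2 := hne T2 f2
  have n1' := hne' T1 f1
  have n2' := hne' T2 f2
  obtain ⟨s, hs⟩ : ∃ s, s = (e + σ e) / 2 := ⟨_, rfl⟩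
  obtain ⟨θ, hθ⟩ : ∃ s, s = (e - σ e) / 2 := ⟨_, rfl⟩
  have ee : e = s + θ := by rw [hs, hθ]; field_simp; ring
  have ese : σ e = s - θ := by rw [hs, hθ]; field_simp; ring
  have ss : σ s = s := by rw [hs]; simp only [map_div₀, map_add, map_sub, map_ofNat, hσ]; ring
  have sθ : σ θ = -θ := by rw [hθ]; simp only [map_div₀, map_add, map_sub, map_ofNat, hσ]; ring
  have θ0 : θ ≠ 0 := by
    intro h0; apply he; rw [ese, ee, h0]; ring
  have γθ : γ = -4 * θ ^ 2 := by rw [hγ, ese, ee]; ring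
  have hfac : (T1 - T2) * ((((T1 + s) * (T2 + s) + 3 * θ ^ 2) - θ * (T1 - T2)) *
      (((T1 + s) * (T2 + s) + 3 * θ ^ 2) + θ * (T1 - T2))) = 0 := by
    rw [ese, ee, γθ] at hh
    rw [ese] at n1' n2'
    rw [ee] at n1 n2
    field_simp at hh
    linear_combination hh
  have hT : T1 = T2 := by
    rcases mul_eq_zero.1 hfac with h0 | h0
    · linear_combination h0
    · have aux : ((T1 + s) * (T2 + s) + 3 * θ ^ 2) - θ * (T1 - T2) = 0 ∧
          ((T1 + s) * (T2 + s) + 3 * θ ^ 2) + θ * (T1 - T2) = 0 := by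
        rcases mul_eq_zero.1 h0 with h1 | h1
        · refine ⟨h1, ?_⟩
          have := congrArg σ h1
          simp only [map_add, map_sub, map_mul, map_pow, f1, f2, ss, sθ, map_zero, map_ofNat] at this
          linear_combination this
        · refine ⟨?_, h1⟩
          have := congrArg σ h1
          simp only [map_add, map_sub, map_mul, map_pow, f1, f2, ss, sθ, map_zero, map_ofNat] at this
          linear_combination this
      have : (2 * θ) * (T1 - T2) = 0 := by linear_combination aux.2 - aux.1
      rcases mul_eq_zero.1 this with h1 | h1
      · exact absurd h1 (mul_ne_zero h2 θ0)
      · linear_combination h1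
  rw [hT] at h
  linear_combination h

/-- The second-order sum over a finite additive subgroup. -/
lemma sum_sq {K : Type} [Field K] [DecidableEq K] (F : Finset K)
    (hsub : ∀ x ∈ F, ∀ y ∈ F, x - y ∈ F) (hadd : ∀ x ∈ F, ∀ y ∈ F, x + y ∈ F)
    (z : K) (hz : ∀ S ∈ F, S + z ≠ 0) :
    ∑ S ∈ F, (1 / (S + z)) ^ 2 = (∑ S ∈ F, 1 / (S + z)) ^ 2 := by
  have hshift : ∀ t ∈ F, ∀ g : K → K, ∑ S ∈ F, g (S + t) = ∑ S ∈ F, g S := by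
    intro t ht g
    refine Finset.sum_bij' (fun S _ => S + t) (fun S _ => S - t) ?_ ?_ ?_ ?_ ?_
    · intro S hS; exact hadd S hS t ht
    · intro S hS; exact hsub S hS t ht
    · intro S _; ring
    · intro S _; ring
    · intro S _; rfl
  rw [sq, Finset.sum_mul_sum]
  have h1 : ∀ S ∈ F, ∑ S' ∈ F, 1 / (S + z) * (1 / (S' + z))
      = ∑ t ∈ F, 1 / (S + z) * (1 / (S + t + z)) := by
    intro S hS
    have := hshift S hS (fun x => 1 / (S + z) * (1 / (x + z)))
    rw [← this]
    refine Finset.sum_congr rfl fun t _ => ?_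
    rw [add_comm t S]
  rw [Finset.sum_congr rfl h1, Finset.sum_comm]
  by_cases hF : F.Nonempty
  · obtain ⟨x, hx⟩ := hF
    have h0 : (0 : K) ∈ F := by simpa using hsub x hx x hx
    refine Eq.trans ?_ (Finset.sum_eq_single_of_mem (0 : K) h0 ?_).symm
    · refine Finset.sum_congr rfl fun S _ => ?_
      rw [add_zero]; ring
    · intro t ht ht0
      have h3 : ∀ S ∈ F, 1 / (S + z) * (1 / (S + t + z))
          = (1 / t) * (1 / (S + z) - 1 / (S + t + z)) := by
        intro S hS
        have a1 := hz S hS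
        have a2 := hz (S + t) (hadd S hS t ht)
        field_simp
        ring
      rw [Finset.sum_congr rfl h3, ← Finset.mul_sum, Finset.sum_sub_distrib,
        hshift t ht (fun x => 1 / (x + z)), sub_self, mul_zero]
  · rw [Finset.not_nonempty_iff_eq_empty] at hF
    simp [hF]

lemma of_inj {K : Type} [Field K] [DecidableEq K] (σ : K →+* K) (hσ : ∀ x, σ (σ x) = x)
    (h2 : (2 : K) ≠ 0) (γ e : K) (he : σ e ≠ e) (F : Finset K)
    (hF : ∀ x, x ∈ F ↔ σ x = x) (hcard : (F.card : K) = 0)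
    (hsum : ∀ z : K, σ z ≠ z → ∑ S ∈ F, 1 / (S + z) = -1 / (σ z - z))
    (hinj : Function.Injective (fun y : K => y + γ / (y + σ y + e))) :
    γ = 0 ∨ γ = -(e - σ e) ^ 2 := by
  obtain ⟨s, hs⟩ : ∃ s, s = (e + σ e) / 2 := ⟨_, rfl⟩
  obtain ⟨θ, hθ⟩ : ∃ s, s = (e - σ e) / 2 := ⟨_, rfl⟩
  have ee : e = s + θ := by rw [hs, hθ]; field_simp; ring
  have ese : σ e = s - θ := by rw [hs, hθ]; field_simp; ring
  have ss : σ s = s := by rw [hs]; simp only [map_div₀, map_add, map_sub, map_ofNat, hσ]; ring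
  have sθ : σ θ = -θ := by rw [hθ]; simp only [map_div₀, map_add, map_sub, map_ofNat, hσ]; ring
  have θ0 : θ ≠ 0 := by
    intro h0; apply he; rw [ese, ee, h0]; ring
  have nθ : σ θ ≠ θ := by
    rw [sθ]; intro h
    have : 2 * θ = 0 := by linear_combination -h
    exact (mul_ne_zero h2 θ0) this
  have nθ' : σ (-θ) ≠ -θ := by
    rw [map_neg]; intro h; exact nθ (neg_injective h)
  have hne : ∀ z : K, σ z ≠ z → ∀ S ∈ F, S + z ≠ 0 := by
    intro z hz T hT h
    apply hz
    have : z = -T := by linear_combination h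
    rw [this, map_neg, (hF T).1 hT]
  have hsub : ∀ x ∈ F, ∀ y ∈ F, x - y ∈ F := by
    intro x hx y hy; rw [hF] at *; rw [map_sub, hx, hy]
  have hadd : ∀ x ∈ F, ∀ y ∈ F, x + y ∈ F := by
    intro x hx y hy; rw [hF] at *; rw [map_add, hx, hy]
  have sA : ∑ S ∈ F, 1 / (S + θ) = 1 / (2 * θ) := by
    rw [hsum θ nθ, sθ, show -θ - θ = -(2 * θ) by ring, neg_div_neg_eq]
  have sB : ∑ S ∈ F, 1 / (S + -θ) = -(1 / (2 * θ)) := by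
    rw [hsum _ nθ', map_neg, sθ, show - -θ - -θ = (2 * θ) by ring, neg_div]
  have sA2 := sum_sq F hsub hadd θ (hne θ nθ)
  have sB2 := sum_sq F hsub hadd (-θ) (hne _ nθ')
  rw [sA] at sA2
  rw [sB] at sB2
  have hmaps : ∀ S ∈ F, S + γ * (1 / (S + θ)) + σ γ * (1 / (S + -θ)) ∈ F := by
    intro S hS
    rw [hF] at hS ⊢
    simp only [map_add, map_mul, map_div₀, map_one, map_neg, hσ, sθ, hS, neg_neg]
    ring
  have hinj2 : Set.InjOn (fun S => S + γ * (1 / (S + θ)) + σ γ * (1 / (S + -θ))) (F : Set K) := by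
    intro S1 hS1 S2 hS2 h
    have hS1' := (hF S1).1 hS1
    have hS2' := (hF S2).1 hS2
    simp only at h
    obtain ⟨y1, hy1⟩ : ∃ y, y = (S1 - s) / 2 := ⟨_, rfl⟩
    have t1 : y1 + σ y1 = S1 - s := by rw [hy1]; simp only [map_div₀, map_sub, map_ofNat, hS1', ss]; field_simp; ring
    obtain ⟨y2, hy2⟩ : ∃ y, y = y1 + γ / (S1 + θ) - γ / (S2 + θ) := ⟨_, rfl⟩
    have sy2 : σ y2 = σ y1 + σ γ / (S1 + -θ) - σ γ / (S2 + -θ) := by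
      rw [hy2]; simp [hS1', hS2', sθ]
    have t2 : y2 + σ y2 = S2 - s := by
      rw [sy2, hy2]; linear_combination t1 + h
    have : y1 = y2 := by
      apply hinj
      simp only
      rw [t1, t2, ee, show S1 - s + (s + θ) = S1 + θ by ring,
        show S2 - s + (s + θ) = S2 + θ by ring, hy2]
      ring
    rw [this, t2] at t1
    linear_combination -t1
  have hperm : ∀ g : K → K,
      ∑ S ∈ F, g (S + γ * (1 / (S + θ)) + σ γ * (1 / (S + -θ))) = ∑ S ∈ F, g S := by
    intro g
    refine Finset.sum_nbij (fun S => S + γ * (1 / (S + θ)) + σ γ * (1 / (S + -θ)))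
      hmaps hinj2 ?_ (fun _ _ => rfl)
    exact Finset.surjOn_of_injOn_of_card_le _ hmaps hinj2 le_rfl
  have p1 := hperm (fun x => x)
  simp only [Finset.sum_add_distrib, ← Finset.mul_sum, sA, sB] at p1
  have hγ : σ γ = γ := by
    have : (γ - σ γ) * (1 / (2 * θ)) = 0 := by linear_combination p1
    rcases mul_eq_zero.1 this with h | h
    · linear_combination -h
    · exact absurd h (one_div_ne_zero (mul_ne_zero h2 θ0))
  have p2 := hperm (fun x => x ^ 2)
  have expd : ∀ S ∈ F, (S + γ * (1 / (S + θ)) + σ γ * (1 / (S + -θ))) ^ 2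
      = S ^ 2 + (4 * γ + (-2 * γ * θ - γ ^ 2 / θ) * (1 / (S + θ))
        + (2 * γ * θ + γ ^ 2 / θ) * (1 / (S + -θ))
        + γ ^ 2 * (1 / (S + θ)) ^ 2 + γ ^ 2 * (1 / (S + -θ)) ^ 2) := by
    intro S hS
    have n1 := hne θ nθ S hS
    have n2 := hne _ nθ' S hS
    rw [hγ]
    field_simp
    ring
  rw [Finset.sum_congr rfl expd] at p2
  simp only [Finset.sum_add_distrib, ← Finset.mul_sum, sA, sB, sA2, sB2, Finset.sum_const,
    nsmul_eq_mul, hcard] at p2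
  have p3 : γ * (γ + 4 * θ ^ 2) = 0 := by
    field_simp at p2
    apply mul_left_cancel₀ h2
    linear_combination -p2
  rcases mul_eq_zero.1 p3 with h | h
  · exact Or.inl h
  · right
    rw [ese, ee]; linear_combination h

open Polynomial in
lemma fq_sum (p n q : ℕ) (hp : p.Prime) (hn : 0 < n) (hq : q = p ^ n)
    (K : Type) [Field K] [Fintype K] [DecidableEq K] [CharP K p] (hK : Fintype.card K = q ^ 2)
    (F : Finset K) (hF : ∀ x, x ∈ F ↔ x ^ q = x) :
    F.card = q ∧ ∀ z : K, z ^ q ≠ z → ∑ S ∈ F, 1 / (S + z) = -1 / (z ^ q - z) := by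
  have : Fact p.Prime := ⟨hp⟩
  have hq1 : 1 < q := by rw [hq]; exact Nat.one_lt_pow hn.ne' hp.one_lt
  have hqK : (q : K) = 0 := by rw [hq]; push_cast; rw [CharP.cast_eq_zero, zero_pow hn.ne']
  have hdvd : (X ^ q - X : K[X]) ∣ X ^ (Fintype.card K) - X := by
    refine ⟨(X ^ q - X) ^ (q - 1) + 1, ?_⟩
    have : (X ^ q - X : K[X]) ^ q = X ^ (q ^ 2) - X ^ q := by
      rw [hq, sub_pow_char_pow, ← pow_mul, ← sq]
    rw [mul_add, mul_one, mul_pow_sub_one (by omega), this, hK]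
    ring
  have hKne : (X ^ (Fintype.card K) - X : K[X]) ≠ 0 :=
    FiniteField.X_pow_card_sub_X_ne_zero K Fintype.one_lt_card
  have hspl : (X ^ q - X : K[X]).Splits := by
    refine Splits.of_dvd ?_ hKne hdvd
    rw [← Nat.card_eq_fintype_card]
    exact Polynomial.splits_X_pow_nat_card_sub_X
  have hne : (X ^ q - X : K[X]) ≠ 0 := FiniteField.X_pow_card_sub_X_ne_zero K hq1
  have hder : derivative (X ^ q - X : K[X]) = -1 := by
    rw [derivative_sub, derivative_X_pow, hqK]; simp
  have hnd : (X ^ q - X : K[X]).roots.Nodup := by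
    apply nodup_roots
    rw [separable_def, hder]
    exact ⟨0, -1, by ring⟩
  have hroots : (X ^ q - X : K[X]).roots = F.val := by
    rw [Multiset.Nodup.ext hnd F.nodup]
    intro x
    rw [mem_roots hne, Finset.mem_val, hF]
    simp [sub_eq_zero]
  constructor
  · rw [Finset.card_def, ← hroots, ← hspl.natDegree_eq_card_roots,
      FiniteField.X_pow_card_sub_X_natDegree_eq K hq1]
  · intro z hz
    have h1 := Splits.eval_derivative_div_eval_of_ne_zero hspl (x := z)
      (by simpa [sub_eq_zero] using hz)
    rw [hder, hroots] at h1
    simp only [eval_neg, eval_one, eval_sub, eval_pow, eval_X] at h1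
    rw [h1]
    change _ = ∑ S ∈ F, 1 / (z - S)
    have hneg : ∀ x ∈ F, -x ∈ F := by
      intro x hx
      rw [hF] at hx ⊢
      have := map_neg (iterateFrobenius K p n) x
      simp only [iterateFrobenius_def, ← hq] at this
      rw [this, hx]
    refine Finset.sum_bij' (fun S _ => -S) (fun S _ => -S) hneg hneg ?_ ?_ ?_
    · intro S _; ring
    · intro S _; ring
    · intro S _; rw [sub_neg_eq_add, add_comm]

/-- Let `q` be a power of an odd prime, `a, b, c ∈ F_{q²}`, `d ∈ F_{q²} \ F_q`,
`γ = a² − ab + c`, `δ = a − b + d` and `ε = a^q − a − b^q + b`. Then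
`(x^{q+1} + x² + a·x^q + b·x + c)/(x^q + x + d)` is a permutation rational function of
`F_{q²}` if and only if `γ ∈ {0, −ε²}`, `δ = 0` and `ε ≠ 0`.
Here `K` plays the role of `F_{q²}` and `F_q = {x : K | x^q = x}`; since `x^q + x + d` has
no zero in `F_{q²}`, being a permutation rational function is equivalent to the map
`x ↦ (x^{q+1} + x² + a·x^q + b·x + c)/(x^q + x + d)` permuting `F_{q²}`. -/
theorem stmt8 (p n q : ℕ) (hp : p.Prime) (hp2 : p ≠ 2) (hn : 0 < n)
    (hq : q = p ^ n)
    (K : Type) [Field K] [Fintype K] (hK : Fintype.card K = q ^ 2)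
    (a b c d : K) (hd : d ^ q ≠ d)
    (γ δ ε : K) (hγ : γ = a ^ 2 - a * b + c) (hδ : δ = a - b + d)
    (hε : ε = a ^ q - a - b ^ q + b) :
    Function.Bijective (fun x : K =>
        (x ^ (q + 1) + x ^ 2 + a * x ^ q + b * x + c) / (x ^ q + x + d)) ↔
      (γ = 0 ∨ γ = -ε ^ 2) ∧ δ = 0 ∧ ε ≠ 0 := by
  classical
  haveI : Fact p.Prime := ⟨hp⟩
  haveI : CharP K p := by
    obtain ⟨r, hr⟩ := CharP.exists K
    have hrp : r.Prime := CharP.char_is_prime K r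
    obtain ⟨m, _, hm⟩ := FiniteField.card K r
    have : r ∣ p ^ (n * 2) := by
      rw [pow_mul, ← hq, ← hK, hm]; exact dvd_pow_self _ m.ne_zero
    have := (Nat.prime_dvd_prime_iff_eq hrp hp).1 (hrp.dvd_of_dvd_pow this)
    rwa [← this]
  obtain ⟨σ, hσq⟩ : ∃ σ : K →+* K, ∀ x, σ x = x ^ q :=
    ⟨iterateFrobenius K p n, fun x => by rw [iterateFrobenius_def, hq]⟩
  have hσ : ∀ x, σ (σ x) = x := by
    intro x; rw [hσq, hσq, ← pow_mul, ← sq, ← hK, FiniteField.pow_card]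
  have h2 : (2 : K) ≠ 0 := by
    intro h
    have h' : ((2 : ℕ) : K) = 0 := by exact_mod_cast h
    rw [CharP.cast_eq_zero_iff K p] at h'
    exact hp2 ((Nat.prime_dvd_prime_iff_eq hp Nat.prime_two).1 h')
  have hqK : (q : K) = 0 := by rw [hq]; push_cast; rw [CharP.cast_eq_zero, zero_pow hn.ne']
  obtain ⟨e, hedef⟩ : ∃ e, e = d - a - σ a := ⟨_, rfl⟩
  have he : σ e ≠ e := by
    intro h
    apply hd
    rw [hedef] at h
    simp only [map_sub, hσ] at h
    rw [← hσq]; linear_combination h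
  rw [← Finite.injective_iff_bijective]
  have hfun : (fun x : K =>
        (x ^ (q + 1) + x ^ 2 + a * x ^ q + b * x + c) / (x ^ q + x + d))
      = (fun y : K => (y * (y + σ y + e - δ) + γ) / (y + σ y + e)) ∘ (fun x => x + a) := by
    funext x
    simp only [Function.comp, map_add, pow_succ x q, ← hσq, hedef, hδ, hγ]
    congr 1 <;> ring
  have hinj : Function.Injective (fun x : K =>
        (x ^ (q + 1) + x ^ 2 + a * x ^ q + b * x + c) / (x ^ q + x + d)) ↔
      Function.Injective (fun y : K => (y * (y + σ y + e - δ) + γ) / (y + σ y + e)) := by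
    rw [hfun]
    exact Function.Injective.of_comp_iff' _ (Equiv.addRight a).bijective
  rw [hinj]
  have hε' : δ = 0 → ε = e - σ e := by
    intro h0
    have hd' : d = b - a := by rw [hδ] at h0; linear_combination h0
    rw [hε, hedef, hd', ← hσq, ← hσq]
    simp only [map_sub, hσ]; ring
  have hf0 : δ = 0 → (fun y : K => (y * (y + σ y + e - δ) + γ) / (y + σ y + e))
      = (fun y : K => y + γ / (y + σ y + e)) := by
    intro h0
    funext y
    have : y + σ y + e ≠ 0 := by
      intro h
      have h' := congrArg σ h
      simp only [map_add, hσ, map_zero] at h'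
      apply he; linear_combination h' - h
    rw [h0]; field_simp; ring
  constructor
  · intro h
    have h0 := delta_zero σ hσ h2 γ δ e he h
    rw [hf0 h0] at h
    have hFm : ∀ x, x ∈ Finset.univ.filter (fun x : K => x ^ q = x) ↔ x ^ q = x := by simp
    obtain ⟨hc, hs⟩ := fq_sum p n q hp hn hq K hK _ hFm
    refine ⟨?_, h0, ?_⟩
    · rw [hε' h0]
      refine of_inj σ hσ h2 γ e he (Finset.univ.filter (fun x : K => x ^ q = x)) ?_ ?_ ?_ h
      · intro x; rw [hFm, hσq]
      · rw [hc, hqK]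
      · intro z hz; rw [hσq] at hz ⊢; exact hs z hz
    · rw [hε' h0]; intro h; apply he; linear_combination -h
  · rintro ⟨hg, h0, -⟩
    rw [hf0 h0]
    rw [hε' h0] at hg
    exact inj_of σ hσ h2 γ e he hg
end

section
/- Let q be any prime power, let β ∈ F_{q²} with β ≠ 0 and set α = −β^q, and let a, b, c ∈ F_{q²} and d ∈ F_{q²} \ F_q. Then (α·x^{2q} + β·x² + a·x^q + b·x + c)/(x^q + x + d) is a permutation rational function of F_{q²} if and only if q = 3, a^q + b ∉ F_q, β² = 1, (b² − a² − βc)² = 1 and β(a − b) − d = 0. -/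
open Finset

section core
variable {K : Type} [Field K]

/-- The numerator of `f(x) - e`, after clearing the denominator. -/
def EE (s : K →+* K) (β a b c d e x : K) : K :=
  -(s β) * (s x) ^ 2 + β * x ^ 2 + a * s x + b * x + c - e * (s x + x + d)

/-- unique solvability -/
def Uniq (s : K →+* K) (β a b c d : K) : Prop :=
  (∀ e, ∃ x, EE s β a b c d e x = 0) ∧
  (∀ e x y, EE s β a b c d e x = 0 → EE s β a b c d e y = 0 → x = y)

lemma theta_ne (s : K →+* K) (hs : ∀ x, s (s x) = x) (β a b c d : K) (hd : s d ≠ d)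
    (H : Uniq s β a b c d) : s (s a + b) ≠ s a + b := by
  intro hθ
  have hdd : d - s d ≠ 0 := fun h => hd (by linear_combination -h)
  obtain ⟨ε, hε⟩ : ∃ ε, ε * (d - s d) = 1 := ⟨_, inv_mul_cancel₀ hdd⟩
  have hsε : s ε = -ε := by
    have h := congrArg s hε
    simp only [map_mul, map_sub, map_one, hs] at h
    apply mul_right_cancel₀ hdd
    linear_combination -h + hε
  obtain ⟨x, hx⟩ := H.1 (ε * (c + s c + 1 - (s a + b) * s d))
  have hx' := congrArg s hx
  unfold EE at hx hx'
  simp only [map_mul, map_sub, map_add, map_neg, map_pow, map_one, map_zero, hs, hsε] at hx hx' hθ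
  have : (1 : K) = 0 := by
    linear_combination -hx - hx' + (s x) * hθ - (c + s c + 1) * hε
      - (s a + b) * (s x + x) * hε - ε * (d * s x + d * x + d * s d) * hθ
  exact one_ne_zero this

lemma even_case (s : K →+* K) (hs : ∀ x, s (s x) = x) (β a b c d : K) (hd : s d ≠ d)
    (h2 : (2 : K) = 0) (H : Uniq s β a b c d) : False := by
  have hθ := theta_ne s hs β a b c d hd H
  have hs2 : ∀ x y : K, x + y = 0 → x = y := fun x y h => by linear_combination h - y * h2
  have hT : s (s a + b) + (s a + b) ≠ 0 := fun h => hθ (hs2 _ _ h)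
  obtain ⟨θ, hθd⟩ : ∃ θ, θ = s a + b := ⟨_, rfl⟩
  have hsθ : s θ = a + s b := by rw [hθd]; simp [hs]
  rw [← hθd] at hT hθ
  obtain ⟨e, he⟩ : ∃ e, e * (s θ + θ) = β * (s θ) ^ 2 + s β * θ ^ 2 + b * s θ + a * θ :=
    ⟨_, div_mul_cancel₀ _ hT⟩
  have hse : s e = e := by
    have h := congrArg s he
    simp only [map_mul, map_add, map_pow, hs] at h
    apply mul_right_cancel₀ hT
    linear_combination h - he - s θ * hθd + θ * hsθ
      + (-(s θ * b) + θ * s b) * h2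
  obtain ⟨x, hx⟩ := H.1 e
  have hy : EE s β a b c d e (x + s θ) = 0 := by
    unfold EE at hx ⊢
    simp only [map_add, hs]
    linear_combination hx - he + (- s β * s x * θ + β * x * s θ - s β * θ ^ 2) * h2
  have := H.2 e _ _ hx hy
  have h0 : s θ = 0 := by linear_combination -this
  have h1 : θ = 0 := by have := congrArg s h0; simpa [hs] using this
  exact hθ (by rw [h0, h1])

/-- The quadratic in `ρ` in odd characteristic. -/
lemma quad (s : K →+* K) (hs : ∀ x, s (s x) = x) (β a b c d ε t m : K)
    (hε : ε * (d - s d) = 1) (hsε : s ε = -ε) (ht : s t = t) (hm : s m = m)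
    (A A' e P L R : K) (hA : A = s a + b - t) (hA' : A' = a + s b - t) (hA0 : A ≠ 0)
    (he : e = ε * (c + s c + 2 * (A * A') * m - t * s d))
    (hP : P = β * A' ^ 2 - s β * A ^ 2)
    (hL : L = 2 * m * (β * A' ^ 2 + s β * A ^ 2) + (b - e) * A' - (a - e) * A)
    (hR : R = m ^ 2 * P + m * ((b - e) * A' + (a - e) * A) + c - e * d)
    (H : Uniq s β a b c d) :
    ∃ ρ, s ρ = -ρ ∧ P * ρ ^ 2 + L * ρ + R = 0 ∧
      ∀ ρ', s ρ' = -ρ' → P * ρ' ^ 2 + L * ρ' + R = 0 → ρ' = ρ := by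
  have hsA : s A = A' := by rw [hA, hA']; simp [hs, ht]
  have hsA' : s A' = A := by rw [← hsA, hs]
  have hA'0 : A' ≠ 0 := by
    intro h; apply hA0; rw [← hsA', h, map_zero]
  have hse : s e = -ε * (c + s c + 2 * (A * A') * m - t * d) := by
    rw [he]
    simp only [map_mul, map_sub, map_add, map_ofNat, hs, hsε, hsA, hsA', ht, hm]
    ring
  have htr : e + s e = t := by rw [hse, he]; linear_combination t * hε
  have htrd : e * d + s e * s d = c + s c + 2 * (A * A') * m := by
    rw [hse, he]; linear_combination (c + s c + 2 * (A * A') * m) * hε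
  have key : ∀ ρ, s ρ = -ρ → EE s β a b c d e (A' * (m + ρ)) = P * ρ ^ 2 + L * ρ + R := by
    intro ρ hρ
    unfold EE
    simp only [map_mul, map_add, hsA', hm, hρ]
    rw [hR, hL, hP]
    ring
  obtain ⟨x, hx⟩ := H.1 e
  have hx1 := hx
  have hx' := congrArg s hx
  unfold EE at hx1 hx'
  simp only [map_mul, map_sub, map_add, map_neg, map_pow, map_zero, hs] at hx'
  have hlin : A * x + A' * s x = 2 * (A * A') * m := by
    linear_combination hx1 + hx' + htrd + x * hA + (s x) * hA' + (x + s x) * htr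
  have hxρ : x = A' * (m + (x / A' - m)) := by field_simp; ring
  have hsρ : s (x / A' - m) = - (x / A' - m) := by
    simp only [map_sub, map_div₀, hsA', hm]
    field_simp
    linear_combination hlin
  refine ⟨x / A' - m, hsρ, ?_, ?_⟩
  · rw [← key _ hsρ, ← hxρ]; exact hx
  · intro ρ' h1 h2
    rw [← key _ h1] at h2
    have := H.2 e _ _ hx h2
    rw [hxρ] at this
    have := mul_left_cancel₀ hA'0 this
    linear_combination -this

lemma quad2 (s : K →+* K) (hs : ∀ x, s (s x) = x) (β a b c d ε t m : K) (h2 : (2 : K) ≠ 0)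
    (hε : ε * (d - s d) = 1) (hsε : s ε = -ε) (ht : s t = t) (hm : s m = m)
    (A A' e P L R : K) (hA : A = s a + b - t) (hA' : A' = a + s b - t) (hA0 : A ≠ 0)
    (he : e = ε * (c + s c + 2 * (A * A') * m - t * s d))
    (hP : P = β * A' ^ 2 - s β * A ^ 2)
    (hL : L = 2 * m * (β * A' ^ 2 + s β * A ^ 2) + (b - e) * A' - (a - e) * A)
    (hR : R = m ^ 2 * P + m * ((b - e) * A' + (a - e) * A) + c - e * d)
    (H : Uniq s β a b c d) :
    (P = 0 → L ≠ 0) ∧ (P ≠ 0 → L ^ 2 = 4 * P * R) := by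
  obtain ⟨ρ, h1, hq, hu⟩ := quad s hs β a b c d ε t m hε hsε ht hm A A' e P L R hA hA' hA0
    he hP hL hR H
  have hsA : s A = A' := by rw [hA, hA']; simp [hs, ht]
  have hsA' : s A' = A := by rw [← hsA, hs]
  have hse : s e = -ε * (c + s c + 2 * (A * A') * m - t * d) := by
    rw [he]
    simp only [map_mul, map_sub, map_add, map_ofNat, hs, hsε, hsA, hsA', ht, hm]
    ring
  have htr : e + s e = t := by rw [hse, he]; linear_combination t * hε
  constructor
  · intro hP0 hL0
    have e1 : ρ + ε = ρ := by
      apply hu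
      · rw [map_add, h1, hsε]; ring
      · rw [hP0, hL0] at hq ⊢; linear_combination hq
    have : ε = 0 := by linear_combination e1
    rw [this, zero_mul] at hε
    exact zero_ne_one hε
  · intro hP0
    have hsP : s P = -P := by
      rw [hP]; simp only [map_mul, map_sub, map_pow, hs, hsA, hsA']; ring
    have hsL : s L = L := by
      rw [hL]
      simp only [map_mul, map_sub, map_add, map_pow, map_ofNat, hs, hsA, hsA', hm]
      linear_combination A' * hA - A * hA' + (A' - A) * htr
    have e1 : -L / P - ρ = ρ := by
      apply hu
      · rw [map_sub, map_div₀, map_neg, h1, hsP, hsL]; field_simp; ring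
      · field_simp; linear_combination P * hq
    have e2 : L = -2 * P * ρ := by
      field_simp at e1; linear_combination -e1
    rw [e2] at hq ⊢
    linear_combination -4 * P * hq

/-- consequences for a fixed trace `t` -/
lemma quad3 (s : K →+* K) (hs : ∀ x, s (s x) = x) (β a b c d ε t : K) (h2 : (2 : K) ≠ 0)
    (hε : ε * (d - s d) = 1) (hsε : s ε = -ε) (ht : s t = t)
    (A A' P : K) (hA : A = s a + b - t) (hA' : A' = a + s b - t) (hA0 : A ≠ 0)
    (hP : P = β * A' ^ 2 - s β * A ^ 2)
    (H : Uniq s β a b c d) :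
    (P = 0 → 2 * β * A' = ε * A * (A' - A)) ∧
    (P ≠ 0 → 4 * β * s β + ε ^ 2 * (A' - A) ^ 2 + 4 * ε * (β * A' - s β * A) = 0 ∧
      (b * A' - a * A - ε * (c + s c - t * s d) * (A' - A)) *
        ((β * A' ^ 2 + s β * A ^ 2) - ε * (A * A') * (A' - A)) =
      P * (b * A' + a * A - ε * (c + s c - t * s d) * (A' + A) - 2 * ε * A * A' * d)) := by
  have hsA : s A = A' := by rw [hA, hA']; simp [hs, ht]
  have hsA' : s A' = A := by rw [← hsA, hs]
  have hA'0 : A' ≠ 0 := by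
    intro h; apply hA0; rw [← hsA', h, map_zero]
  have Q := fun m hm => quad2 s hs β a b c d ε t m h2 hε hsε ht hm A A' _ P _ _ hA hA' hA0
    rfl hP rfl rfl H
  have h4 : (4 : K) ≠ 0 := by
    have : (4 : K) = 2 * 2 := by norm_num
    rw [this]; exact mul_ne_zero h2 h2
  constructor
  · intro hP0
    have hP1 := hP0
    rw [hP] at hP1
    by_contra hne
    -- slope and intercept
    obtain ⟨L1, hL1⟩ : ∃ L1, L1 = 2 * (β * A' ^ 2 + s β * A ^ 2) - 2 * ε * (A * A') * (A' - A) :=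
      ⟨_, rfl⟩
    obtain ⟨L0, hL0⟩ : ∃ L0, L0 = b * A' - a * A - ε * (c + s c - t * s d) * (A' - A) :=
      ⟨_, rfl⟩
    have hL1n : L1 ≠ 0 := by
      intro h
      apply hne
      apply mul_left_cancel₀ (mul_ne_zero h2 hA'0)
      linear_combination h - hL1 + 2 * hP1
    have hs1 : s L1 = L1 := by
      rw [hL1]
      simp only [map_mul, map_sub, map_add, map_pow, map_ofNat, hs, hsA, hsA', hsε]
      ring
    have hs0 : s L0 = L0 := by
      rw [hL0]
      simp only [map_mul, map_sub, map_add, hs, hsA, hsA', hsε, ht]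
      linear_combination A' * hA - A * hA' + (A' - A) * t * hε
    refine (Q (-L0 / L1) (by rw [map_div₀, map_neg, hs0, hs1])).1 hP0 ?_
    have : L1 * (-L0 / L1) + L0 = 0 := by field_simp; ring
    linear_combination this - (-L0 / L1) * hL1 - hL0
  · intro hP0
    have q0 := (Q 0 (map_zero s)).2 hP0
    have q1 := (Q 1 (map_one s)).2 hP0
    have q2 := (Q (-1) (by simp)).2 hP0
    constructor
    · have hN : (A * A') ^ 2 * 4 * 2 ≠ 0 :=
        mul_ne_zero (mul_ne_zero (pow_ne_zero _ (mul_ne_zero hA0 hA'0)) h4) h2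
      apply mul_left_cancel₀ hN
      rw [hP] at q0 q1 q2
      linear_combination q1 + q2 - 2 * q0
    · apply mul_left_cancel₀ (mul_ne_zero h4 h2)
      linear_combination q1 - q2

lemma odd_case1 (s : K →+* K) (hs : ∀ x, s (s x) = x) (β a b c d : K) (h2 : (2 : K) ≠ 0)
    (hβ : β ≠ 0) (hd : s d ≠ d) (H : Uniq s β a b c d) :
    s β = β ∧ a = b - 2 * β * d := by
  have hdd : d - s d ≠ 0 := fun h => hd (by linear_combination -h)
  obtain ⟨ε, hε⟩ : ∃ ε, ε * (d - s d) = 1 := ⟨_, inv_mul_cancel₀ hdd⟩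
  have hε0 : ε ≠ 0 := by rintro rfl; simp at hε
  have hsε : s ε = -ε := by
    have h := congrArg s hε
    simp only [map_mul, map_sub, map_one, hs] at h
    apply mul_right_cancel₀ hdd
    linear_combination -h + hε
  have hθ := theta_ne s hs β a b c d hd H
  rw [map_add, hs] at hθ
  have hA0 : ∀ t, s t = t → s a + b - t ≠ 0 := by
    intro t ht h
    have h' := congrArg s h
    simp only [map_sub, map_add, hs, ht, map_zero] at h'
    exact hθ (by linear_combination h' - h)
  have h4 : (4 : K) ≠ 0 := by
    have : (4 : K) = 2 * 2 := by norm_num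
    rw [this]; exact mul_ne_zero h2 h2
  have Q := fun t ht => quad3 s hs β a b c d ε t h2 hε hsε ht _ _ _ rfl rfl (hA0 t ht) rfl H
  -- at most one root
  have one : ∀ t u, s t = t → s u = u → t ≠ u →
      β * (a + s b - t) ^ 2 - s β * (s a + b - t) ^ 2 = 0 →
      β * (a + s b - u) ^ 2 - s β * (s a + b - u) ^ 2 ≠ 0 := by
    intro t u ht hu htu h h'
    have e1 := (Q t ht).1 h
    have e2 := (Q u hu).1 h'
    have e3 : 2 * β = ε * (a + s b - (s a + b)) := by
      apply mul_right_cancel₀ (sub_ne_zero.2 htu)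
      linear_combination e2 - e1
    have e4 : ε * (a + s b - (s a + b)) * (a + s b - (s a + b)) = 0 := by
      linear_combination e1 - (a + s b - t) * e3
    have e5 : a + s b - (s a + b) ≠ 0 := sub_ne_zero.2 hθ
    exact mul_ne_zero (mul_ne_zero hε0 e5) e5 e4
  -- two non-roots
  have two : ∃ t u, s t = t ∧ s u = u ∧ t ≠ u ∧
      β * (a + s b - t) ^ 2 - s β * (s a + b - t) ^ 2 ≠ 0 ∧
      β * (a + s b - u) ^ 2 - s β * (s a + b - u) ^ 2 ≠ 0 := by
    have n01 : (0 : K) ≠ 1 := zero_ne_one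
    have n1 : (1 : K) ≠ -1 := fun h => h2 (by linear_combination h)
    have n0 : (0 : K) ≠ -1 := fun h => n01 (by linear_combination -h)
    have s0 : s 0 = 0 := map_zero s
    have s1 : s 1 = 1 := map_one s
    have sm : s (-1) = -1 := by simp
    by_cases r0 : β * (a + s b - 0) ^ 2 - s β * (s a + b - 0) ^ 2 = 0
    · exact ⟨1, -1, s1, sm, n1, one 0 1 s0 s1 n01 r0, one 0 (-1) s0 sm n0 r0⟩
    · by_cases r1 : β * (a + s b - 1) ^ 2 - s β * (s a + b - 1) ^ 2 = 0
      · exact ⟨0, -1, s0, sm, n0, r0, one 1 (-1) s1 sm n1 r1⟩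
      · exact ⟨0, 1, s0, s1, n01, r0, r1⟩
  obtain ⟨t, u, ht, hu, htu, hPt, hPu⟩ := two
  obtain ⟨c2t, c1t⟩ := (Q t ht).2 hPt
  obtain ⟨c2u, -⟩ := (Q u hu).2 hPu
  have hsβ : s β = β := by
    apply mul_left_cancel₀ (mul_ne_zero (mul_ne_zero h4 hε0) (sub_ne_zero.2 htu))
    linear_combination c2t - c2u
  refine ⟨hsβ, ?_⟩
  rw [hsβ] at c2t c1t hPt
  have hκ : ε * (a + s b - (s a + b)) = -2 * β := by
    have : (ε * (a + s b - (s a + b)) + 2 * β) ^ 2 = 0 := by linear_combination c2t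
    have := pow_eq_zero_iff (two_ne_zero) |>.1 this
    linear_combination this
  obtain ⟨A, hA⟩ : ∃ A, A = s a + b - t := ⟨_, rfl⟩
  obtain ⟨A', hA'⟩ : ∃ A', A' = a + s b - t := ⟨_, rfl⟩
  have hAn : A ≠ 0 := hA ▸ hA0 t ht
  have hsA : s A = A' := by rw [hA, hA']; simp [hs, ht]
  have hA'n : A' ≠ 0 := by
    intro h; apply hAn; rw [← hs A, hsA, h, map_zero]
  rw [← hA, ← hA'] at c1t hPt
  have hκ' : ε * (A' - A) = -2 * β := by rw [hA, hA']; linear_combination hκ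
  have hsum : A + A' ≠ 0 := by
    intro h; apply hPt; linear_combination β * (A' - A) * h
  have hf : 2 * β * (A + A') * (A * A') ≠ 0 :=
    mul_ne_zero (mul_ne_zero (mul_ne_zero h2 hβ) hsum) (mul_ne_zero hAn hA'n)
  apply mul_left_cancel₀ hf
  linear_combination -c1t + (2 * A * A' * d * β * (A + A') -
    (b * A' - a * A - ε * (c + s c - t * s d) * (A' - A)) * (A * A')) * hκ'

lemma den_ne (s : K →+* K) (d v : K) (hd : s d ≠ d) (hv : s v = v) : v + d ≠ 0 := by
  intro h
  have h' := congrArg s h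
  rw [map_add, hv, map_zero] at h'
  exact hd (by linear_combination h' - h)

lemma odd_case2 (s : K →+* K) (hs : ∀ x, s (s x) = x) (β b c d k C : K) (h2 : (2 : K) ≠ 0)
    (hβ : β ≠ 0) (hd : s d ≠ d) (hsβ : s β = β) (hk : k = b - β * d) (hC : C = c - d * k)
    (H : Uniq s β (b - 2 * β * d) b c d) :
    C + s C ≠ 0 ∧ (∀ v, s v = v → v ≠ 0 → v ^ 2 = 1) ∧
      C * s C * (-(d - s d) ^ 2) = (C + s C) ^ 2 := by
  have hd' : s (s d) ≠ s d := by rw [hs]; exact hd.symm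
  have n1 := fun v hv => den_ne s d v hd hv
  have n2 := fun v hv => den_ne s (s d) v hd' hv
  have inj : ∀ v w, s v = v → s w = w →
      (v * (C + s C) + (C * s d + s C * d)) * ((w + d) * (w + s d)) =
      (w * (C + s C) + (C * s d + s C * d)) * ((v + d) * (v + s d)) → v = w := by
    intro v w hv hw h
    have := n1 v hv
    have := n1 w hw
    have := n2 v hv
    have := n2 w hw
    obtain ⟨z, hz⟩ : ∃ z, z = C / (v + d) - C / (w + d) := ⟨_, rfl⟩
    have hsz : s z = -z := by
      rw [hz]
      simp only [map_sub, map_div₀, map_add, hv, hw]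
      field_simp
      linear_combination h
    have hz' : z * ((v + d) * (w + d)) = C * (w + d) - C * (v + d) := by
      rw [hz]; field_simp
    have hx : EE s β (b - 2 * β * d) b c d (k + C / (v + d)) (v / 2) = 0 := by
      unfold EE
      simp only [map_div₀, map_ofNat, hv, hsβ]
      field_simp
      rw [hC, hk]
      ring
    have hy : EE s β (b - 2 * β * d) b c d (k + C / (v + d)) ((w + z / β) / 2) = 0 := by
      unfold EE
      simp only [map_div₀, map_add, map_ofNat, hw, hsβ, hsz]
      have e1 : C / (v + d) = z + C / (w + d) := by rw [hz]; ring
      rw [e1]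
      field_simp
      rw [hC, hk]
      ring
    have h1 := H.2 _ _ _ hx hy
    have h3 := congrArg s h1
    simp only [map_div₀, map_add, map_ofNat, hv, hw, hsβ, hsz] at h3
    have h4 : v / 2 + v / 2 = w / 2 + w / 2 := by
      linear_combination h1 + h3
    linear_combination h4 + (w - v) * (mul_inv_cancel₀ h2)
  have hT : C + s C ≠ 0 := by
    intro hT
    have hfix : s (-(d + s d)) = -(d + s d) := by simp [hs]; ring
    have hfix1 : s (-(d + s d) - 1) = -(d + s d) - 1 := by simp [hs]; ring
    have e0 := inj 0 (-(d + s d)) (map_zero s) hfix (by rw [hT]; ring)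
    have e1 := inj 1 (-(d + s d) - 1) (map_one s) hfix1 (by rw [hT]; ring)
    exact h2 (by linear_combination e1 - e0)
  refine ⟨hT, ?_⟩
  obtain ⟨v1, hv1⟩ : ∃ v1, v1 * (C + s C) = -(C * s d + s C * d) := ⟨_, div_mul_cancel₀ _ hT⟩
  have hsv1 : s v1 = v1 := by
    have h := congrArg s hv1
    simp only [map_mul, map_add, map_neg, hs] at h
    apply mul_right_cancel₀ hT
    linear_combination h - hv1
  obtain ⟨r, hr⟩ : ∃ r, r = (v1 + d) * (v1 + s d) := ⟨_, rfl⟩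
  have hsr : s r = r := by
    rw [hr]; simp only [map_mul, map_add, hs, hsv1]; ring
  have hr0 : r ≠ 0 := by rw [hr]; exact mul_ne_zero (n1 _ hsv1) (n2 _ hsv1)
  have sq : ∀ v, s v = v → v ≠ 0 → v ^ 2 = r := by
    intro v hv hv0
    have := inj (v1 + v) (v1 + r / v) (by rw [map_add, hv, hsv1])
      (by rw [map_add, map_div₀, hv, hsv1, hsr]) (by
        have e1 : (v1 + v) * (C + s C) + (C * s d + s C * d) = v * (C + s C) := by
          linear_combination hv1
        have e2 : (v1 + r / v) * (C + s C) + (C * s d + s C * d) = r / v * (C + s C) := by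
          linear_combination hv1
        have e3 : (v1 + v + d) * (v1 + v + s d) = v ^ 2 + v * (2 * v1 + d + s d) + r := by
          rw [hr]; ring
        have e4 : (v1 + r / v + d) * (v1 + r / v + s d)
            = (r / v) ^ 2 + (r / v) * (2 * v1 + d + s d) + r := by
          linear_combination -hr
        rw [e1, e2, e3, e4]
        field_simp
        ring)
    have h := add_left_cancel this
    field_simp at h
    exact h
  have hr1 : r = 1 := by rw [← sq 1 (map_one s) one_ne_zero]; ring
  constructor
  · intro v hv hv0; rw [sq v hv hv0, hr1]
  · have e1 : (C + s C) * (v1 + d) = C * (d - s d) := by linear_combination hv1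
    have e2 : (C + s C) * (v1 + s d) = - (s C * (d - s d)) := by linear_combination hv1
    have : (C + s C) ^ 2 * ((v1 + d) * (v1 + s d)) = C * (d - s d) * (- (s C * (d - s d))) := by
      rw [← e1, ← e2]; ring
    rw [← hr, hr1] at this
    linear_combination -this

/-- if the fixed field is contained in `{0, 1, -1}` then `K` has at most nine elements -/
lemma card_le [Fintype K] (s : K →+* K) (hs : ∀ x, s (s x) = x) (d : K) (h2 : (2 : K) ≠ 0)
    (hd : s d ≠ d) (h : ∀ v, s v = v → v ≠ 0 → v ^ 2 = 1) : Fintype.card K ≤ 9 := by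
  classical
  have hdd : d - s d ≠ 0 := fun h => hd (by linear_combination -h)
  have hF : ∀ v, s v = v → v ∈ ({0, 1, -1} : Finset K) := by
    intro v hv
    by_cases h0 : v = 0
    · simp [h0]
    · have := h v hv h0
      have h5 : (v - 1) * (v + 1) = 0 := by linear_combination this
      rcases mul_eq_zero.1 h5 with h | h
      · simp [sub_eq_zero.1 h]
      · simp [eq_neg_of_add_eq_zero_left h]
  have hc : ((({0, 1, -1} : Finset K)) ×ˢ ({0, 1, -1} : Finset K)).card ≤ 9 := by
    rw [Finset.card_product]
    have := Finset.card_le_three (a := (0 : K)) (b := 1) (c := -1)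
    nlinarith
  refine le_trans ?_ hc
  rw [← Finset.card_univ]
  apply Finset.card_le_card_of_injOn (fun x => (x + s x, (x - s x) / (d - s d)))
  · intro x _
    simp only [Finset.coe_product, Set.mem_prod, Finset.mem_coe]
    constructor
    · apply hF; rw [map_add, hs]; ring
    · apply hF
      simp only [map_div₀, map_sub, hs]
      rw [← neg_sub x, ← neg_sub d, neg_div_neg_eq]
  · intro x _ y _ hxy
    simp only [Prod.mk.injEq] at hxy
    obtain ⟨e1, e2⟩ := hxy
    field_simp at e2
    apply mul_left_cancel₀ h2
    linear_combination e1 + e2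

/-- the converse in characteristic three -/
lemma converse (s : K →+* K) (hs : ∀ x, s (s x) = x) (β a b c d : K) (h3 : (3 : K) = 0)
    (hs3 : ∀ x, s x = x ^ 3) (hd : s d ≠ d) (hβ : β ^ 2 = 1)
    (hC : (b ^ 2 - a ^ 2 - β * c) ^ 2 = 1) (hab : β * (a - b) - d = 0) :
    Function.Injective (fun x : K =>
      (-(s β) * (s x) ^ 2 + β * x ^ 2 + a * s x + b * x + c) / (s x + x + d)) := by
  have hsβ : s β = β := by rw [hs3]; linear_combination β * hβ
  have ha : a = b + β * d := by linear_combination β * hab - (a - b) * hβ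
  obtain ⟨C, hCd⟩ : ∃ C, C = c - d * (b - β * d) := ⟨_, rfl⟩
  have hC1 : C ^ 2 = 1 := by
    have : b ^ 2 - a ^ 2 - β * c = - β * C := by
      rw [hCd, ha]; linear_combination -b * β * d * h3
    rw [this] at hC
    linear_combination hC - C ^ 2 * hβ
  have hsC : s C = C := by rw [hs3]; linear_combination C * hC1
  have hC0 : C ≠ 0 := by rintro rfl; simp at hC1
  have hβ0 : β ≠ 0 := by rintro rfl; simp at hβ
  have h2 : (2 : K) ≠ 0 := fun h => one_ne_zero (α := K) (by linear_combination h3 - h)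
  have hd' : s (s d) ≠ s d := by rw [hs]; exact hd.symm
  have hfx : ∀ x, s (s x + x) = s x + x := by intro x; rw [map_add, hs]; ring
  have n1 := fun x => den_ne s d _ hd (hfx x)
  have n2 := fun x => den_ne s (s d) _ hd' (hfx x)
  have hdec : ∀ x, (-(s β) * (s x) ^ 2 + β * x ^ 2 + a * s x + b * x + c) / (s x + x + d)
      = β * (x - s x) + (b - β * d) + C / (s x + x + d) := by
    intro x
    have := n1 x
    field_simp
    rw [hsβ, ha, hCd]
    linear_combination β * d * s x * h3
  have hD : (d - s d) ^ 2 = -1 := by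
    have hDn : d - s d ≠ 0 := fun h => hd (by linear_combination -h)
    have e : s (d - s d) = -(d - s d) := by rw [map_sub, hs]; ring
    rw [hs3] at e
    apply mul_left_cancel₀ hDn
    linear_combination e
  intro x y hxy
  simp only [hdec] at hxy
  have hxy' := congrArg s hxy
  simp only [map_add, map_mul, map_div₀, map_sub, hs, hsβ, hsC] at hxy'
  obtain ⟨v, hv⟩ : ∃ v, v = s x + x := ⟨_, rfl⟩
  obtain ⟨w, hw⟩ : ∃ w, w = s y + y := ⟨_, rfl⟩
  have hvf : s v = v := hv ▸ hfx x
  have hwf : s w = w := hw ▸ hfx y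
  have nv1 := n1 x
  have nv2 := n2 x
  have nw1 := n1 y
  have nw2 := n2 y
  rw [add_comm x (s x), add_comm y (s y)] at hxy'
  rw [← hv, ← hw] at hxy hxy'
  rw [← hv] at nv1 nv2
  rw [← hw] at nw1 nw2
  have tr : C / (v + d) + C / (v + s d) = C / (w + d) + C / (w + s d) := by
    linear_combination hxy + hxy'
  have tr2 : (2 * v + d + s d) * ((w + d) * (w + s d)) =
      (2 * w + d + s d) * ((v + d) * (v + s d)) := by
    field_simp at tr
    linear_combination tr
  -- shifted variables
  obtain ⟨u, hu⟩ : ∃ u, u = v - (d + s d) := ⟨_, rfl⟩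
  obtain ⟨z, hz⟩ : ∃ z, z = w - (d + s d) := ⟨_, rfl⟩
  have huf : s u = u := by rw [hu]; simp only [map_sub, map_add, hs, hvf]; ring
  have eu : (v + d) * (v + s d) = u ^ 2 + 1 := by
    rw [hu]; linear_combination (v * (d + s d) - d * s d) * h3 - hD
  have ez : (w + d) * (w + s d) = z ^ 2 + 1 := by
    rw [hz]; linear_combination (w * (d + s d) - d * s d) * h3 - hD
  have eu2 : 2 * v + d + s d = 2 * u := by rw [hu]; linear_combination (d + s d) * h3
  have ez2 : 2 * w + d + s d = 2 * z := by rw [hz]; linear_combination (d + s d) * h3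
  rw [eu, ez, eu2, ez2] at tr2
  have hfac : (u - z) * (1 - u * z) = 0 := by
    apply mul_left_cancel₀ h2
    linear_combination tr2
  have huz : u = z := by
    rcases mul_eq_zero.1 hfac with h | h
    · exact sub_eq_zero.1 h
    · have hu0 : u ≠ 0 := by rintro rfl; simp at h
      have hu2 : u ^ 2 = 1 := by
        rw [hs3] at huf
        apply mul_left_cancel₀ hu0
        linear_combination huf
      linear_combination u * h + z * hu2
  have hvw : v = w := by linear_combination huz - hu + hz
  rw [hvw] at hxy
  have e1 : x - s x = y - s y := by
    apply mul_left_cancel₀ hβ0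
    linear_combination hxy
  apply mul_left_cancel₀ h2
  linear_combination e1 + hvw - hv + hw

end core

theorem stmt15 (p n q : ℕ) (hp : p.Prime) (hn : 0 < n) (hq : q = p ^ n)
    (K : Type) [Field K] [Fintype K] (hK : Fintype.card K = q ^ 2)
    (β α : K) (hβ : β ≠ 0) (hα : α = -β ^ q)
    (a b c d : K) (hd : d ^ q ≠ d) :
    Function.Bijective (fun x : K =>
        (α * x ^ (2 * q) + β * x ^ 2 + a * x ^ q + b * x + c) / (x ^ q + x + d)) ↔
      (q = 3 ∧ (a ^ q + b) ^ q ≠ a ^ q + b ∧ β ^ 2 = 1 ∧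
        (b ^ 2 - a ^ 2 - β * c) ^ 2 = 1 ∧ β * (a - b) - d = 0) := by
  have hq2 : 2 ≤ q := hq ▸ le_trans hp.two_le (Nat.le_self_pow hn.ne' p)
  haveI : Fact p.Prime := ⟨hp⟩
  haveI hch : CharP K p := by
    obtain ⟨r, hr⟩ := CharP.exists K
    obtain ⟨k, hrp, hk⟩ := FiniteField.card K r
    have h1 : p ∣ r ^ (k : ℕ) := by
      rw [← hk, hK, hq]; exact dvd_pow (dvd_pow_self p hn.ne') two_ne_zero
    have h2 : p = r := (Nat.prime_dvd_prime_iff_eq hp hrp).1 (hp.dvd_of_dvd_pow h1)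
    rw [h2]; exact hr
  obtain ⟨s, hsq⟩ : ∃ s : K →+* K, ∀ x, s x = x ^ q :=
    ⟨iterateFrobenius K p n, fun x => by rw [iterateFrobenius_def, hq]⟩
  have hs : ∀ x, s (s x) = x := by
    intro x
    rw [hsq, hsq, ← pow_mul, ← pow_two, ← hK, FiniteField.pow_card]
  have hfun : (fun x : K =>
        (α * x ^ (2 * q) + β * x ^ 2 + a * x ^ q + b * x + c) / (x ^ q + x + d)) =
      (fun x : K => (-(s β) * (s x) ^ 2 + β * x ^ 2 + a * s x + b * x + c) / (s x + x + d)) := by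
    funext x
    rw [hsq, hsq, hα, ← pow_mul, mul_comm 2 q]
  rw [hfun]
  rw [← hsq] at hd
  have hden : ∀ x, s x + x + d ≠ 0 := fun x =>
    den_ne s d _ hd (by rw [map_add, hs]; ring)
  constructor
  · intro hbij
    have H : Uniq s β a b c d := by
      have hiff : ∀ e x, EE s β a b c d e x = 0 ↔
          (-(s β) * (s x) ^ 2 + β * x ^ 2 + a * s x + b * x + c) / (s x + x + d) = e := by
        intro e x
        rw [div_eq_iff (hden x), EE, sub_eq_zero]
      refine ⟨fun e => ?_, fun e x y hx hy => ?_⟩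
      · obtain ⟨x, hx⟩ := hbij.2 e
        exact ⟨x, (hiff e x).2 hx⟩
      · exact hbij.1 (((hiff e x).1 hx).trans ((hiff e y).1 hy).symm)
    have h2 : (2 : K) ≠ 0 := fun h => even_case s hs β a b c d hd h H
    have hθ := theta_ne s hs β a b c d hd H
    obtain ⟨hsβ, hab⟩ := odd_case1 s hs β a b c d h2 hβ hd H
    rw [hab] at H
    obtain ⟨hT, hF, hN⟩ := odd_case2 s hs β b c d _ _ h2 hβ hd hsβ rfl rfl H
    have hcard := card_le s hs d h2 hd hF
    have hp2 : p ≠ 2 := by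
      intro h
      apply h2
      have := CharP.cast_eq_zero K p
      rw [h] at this
      exact_mod_cast this
    have hq3 : q = 3 := by
      rw [hK] at hcard
      have : q ≤ 3 := by nlinarith
      interval_cases q
      · exfalso
        apply hp2
        have : p ∣ 2 := hq ▸ dvd_pow_self p hn.ne'
        exact (Nat.prime_dvd_prime_iff_eq hp Nat.prime_two).1 this
      · rfl
    have hp3 : p = 3 := by
      have : p ∣ 3 := by rw [← hq3, hq]; exact dvd_pow_self p hn.ne'
      exact (Nat.prime_dvd_prime_iff_eq hp Nat.prime_three).1 this
    have h3 : (3 : K) = 0 := by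
      have := CharP.cast_eq_zero K p
      rw [hp3] at this
      exact_mod_cast this
    have hβ2 := hF β hsβ hβ
    refine ⟨hq3, ?_, hβ2, ?_, ?_⟩
    · rw [← hsq, ← hsq]; exact hθ
    · obtain ⟨C, hC⟩ : ∃ C, C = c - d * (b - β * d) := ⟨_, rfl⟩
      rw [← hC] at hT hN
      have hsC : s C = C ^ 3 := by rw [hsq, hq3]
      have hDn : d - s d ≠ 0 := fun h => hd (by linear_combination -h)
      have hD : (d - s d) ^ 2 = -1 := by
        have e : s (d - s d) = -(d - s d) := by rw [map_sub, hs]; ring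
        rw [hsq, hq3] at e
        apply mul_left_cancel₀ hDn
        linear_combination e
      have hT2 := hF (C + s C) (by rw [map_add, hs]; ring) hT
      rw [hD, hT2, hsC] at hN
      rw [hsC] at hT
      have hne : C ^ 2 + 1 ≠ 0 := by
        intro h; apply hT; linear_combination C * h
      have hC2 : C ^ 2 = 1 := by
        apply mul_left_cancel₀ hne
        linear_combination hN
      have : b ^ 2 - a ^ 2 - β * c = -β * C := by
        rw [hC, hab]
        linear_combination (b * β * d - β ^ 2 * d ^ 2) * h3
      rw [this]
      linear_combination C ^ 2 * hβ2 + hC2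
    · rw [hab]
      linear_combination -2 * d * hβ2 - d * h3
  · rintro ⟨hq3, -, hβ2, hC, hab⟩
    have hp3 : p = 3 := by
      have : p ∣ 3 := by rw [← hq3, hq]; exact dvd_pow_self p hn.ne'
      exact (Nat.prime_dvd_prime_iff_eq hp Nat.prime_three).1 this
    have h3 : (3 : K) = 0 := by
      have := CharP.cast_eq_zero K p
      rw [hp3] at this
      exact_mod_cast this
    exact Finite.injective_iff_bijective.1
      (converse s hs β a b c d h3 (fun x => by rw [hsq, hq3]) hd hβ2 hC hab)
end
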